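/- Suppose Λ is a probability measure on [0,1] with Λ([0,x]) = A x^α + O(x^{α+ς}) as x↓0, where 0<α<1, A>0, ς>0. Then the moments ν_n = ∫_0^1 (1-x)^n Λ(dx) satisfy ν_n = A Γ(α+1) n^{−α} + O(n^{−α−ς'}) as n→∞, where ς' = min{1, ς}. -/

import Mathlib

open MeasureTheory Filter Asymptotics

/-- Moments `ν_k = ∫_0^1 (1-x)^k Λ(dx)`. -/
noncomputable def nuMom (Λ : Measure ℝ) (k : ℕ) : ℝ :=
  ∫ x in Set.Icc (0:ℝ) 1, (1 - x) ^ k ∂Λ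

/-- pow primitive -/
lemma aux_pow (m : ℕ) (x : ℝ) (hx0 : 0 ≤ x) (hx1 : x ≤ 1) :
    (1 - x) ^ (m+1) = ∫ t in Set.Ioc (0:ℝ) 1, (Set.Ici x).indicator (fun t => (m+1:ℝ) * (1 - t) ^ m) t := by
  have h1 : ∫ t in x..1, (m+1:ℝ) * (1 - t) ^ m = (1 - x) ^ (m+1) := by
    have := intervalIntegral.integral_eq_sub_of_hasDerivAt (a := x) (b := 1)
      (f := fun t : ℝ => -(1 - t) ^ (m+1)) (f' := fun t => (m+1:ℝ) * (1 - t) ^ m)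
      (fun t _ => by
        have := (((hasDerivAt_id t).const_sub 1).pow (m+1)).neg
        refine (this.congr_deriv ?_)
        simp) (Continuous.intervalIntegrable (by fun_prop) _ _)
    rw [this]; simp
  rw [← h1, setIntegral_indicator measurableSet_Ici, intervalIntegral.integral_of_le hx1]
  apply setIntegral_congr_set
  have : (Set.Ioc (0:ℝ) 1 ∩ Set.Ici x : Set ℝ) =ᵐ[volume] (Set.Ioc (0:ℝ) 1 ∩ Set.Ioi x : Set ℝ) :=
    (ae_eq_refl _).inter Ioi_ae_eq_Ici.symm
  suffices hs : Set.Ioc (0:ℝ) 1 ∩ Set.Ioi x = Set.Ioc x 1 by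
    rw [hs] at this; exact this.symm
  ext t; simp only [Set.mem_inter_iff, Set.mem_Ioc, Set.mem_Ioi]
  constructor
  · rintro ⟨⟨a, b⟩, c⟩; exact ⟨c, b⟩
  · rintro ⟨a, b⟩; exact ⟨⟨by linarith, b⟩, a⟩

lemma aux_fubini (Λ : Measure ℝ) [IsProbabilityMeasure Λ] (m : ℕ) :
    nuMom Λ (m+1) = ∫ t in Set.Ioc (0:ℝ) 1, (m+1:ℝ) * (1 - t) ^ m * (Λ (Set.Icc 0 t)).toReal := by
  unfold nuMom
  have e1 : ∫ x in Set.Icc (0:ℝ) 1, (1 - x) ^ (m+1) ∂Λ = ∫ x in Set.Icc (0:ℝ) 1,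
      (∫ t in Set.Ioc (0:ℝ) 1, (Set.Ici x).indicator (fun t => (m+1:ℝ) * (1 - t) ^ m) t) ∂Λ :=
    setIntegral_congr_fun measurableSet_Icc fun x hx => aux_pow m x hx.1 hx.2
  rw [e1, integral_integral_swap]
  · apply setIntegral_congr_fun measurableSet_Ioc
    intro t ht
    have : ∀ x : ℝ, (Set.Ici x).indicator (fun t => (m+1:ℝ) * (1 - t) ^ m) t
        = (Set.Iic t).indicator (fun _ => (m+1:ℝ) * (1 - t) ^ m) x := by
      intro x; simp [Set.indicator_apply]
    simp only [this]
    rw [setIntegral_indicator measurableSet_Iic, setIntegral_const]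
    have : Set.Icc (0:ℝ) 1 ∩ Set.Iic t = Set.Icc 0 t := by
      ext y; simp only [Set.mem_inter_iff, Set.mem_Icc, Set.mem_Iic]
      constructor
      · rintro ⟨⟨a, b⟩, c⟩; exact ⟨a, c⟩
      · rintro ⟨a, b⟩; exact ⟨⟨a, b.trans ht.2⟩, b⟩
    rw [this, smul_eq_mul, mul_comm]; rfl
  · have hm : Measurable (Function.uncurry fun x t : ℝ =>
        (Set.Ici x).indicator (fun t => (m+1:ℝ) * (1 - t) ^ m) t) := by
      have : (Function.uncurry fun x t : ℝ =>
        (Set.Ici x).indicator (fun t => (m+1:ℝ) * (1 - t) ^ m) t) =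
        {p : ℝ × ℝ | p.1 ≤ p.2}.indicator (fun p => (m+1:ℝ) * (1 - p.2) ^ m) := by
        ext ⟨x, t⟩; simp [Set.indicator_apply]
      rw [this]
      exact Measurable.indicator (by fun_prop) (measurableSet_le measurable_fst measurable_snd)
    refine Integrable.of_bound hm.aestronglyMeasurable (m+1:ℝ) ?_
    rw [Measure.prod_restrict]
    refine (ae_restrict_iff' (measurableSet_Icc.prod measurableSet_Ioc)).2 (ae_of_all _ ?_)
    rintro ⟨x, t⟩ ⟨hx, ht⟩
    simp only [Set.mem_Icc, Set.mem_Ioc] at hx ht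
    refine (norm_indicator_le_norm_self (fun t : ℝ => (m+1:ℝ) * (1 - t) ^ m) t).trans ?_
    rw [Real.norm_eq_abs, abs_of_nonneg (mul_nonneg (by positivity) (pow_nonneg (by linarith) _))]
    have : (1 - t) ^ m ≤ 1 := pow_le_one₀ (by linarith) (by linarith)
    nlinarith [(Nat.cast_nonneg m : (0:ℝ) ≤ m)]

lemma aux_beta (m : ℕ) (α : ℝ) (hα : 0 < α) :
    ∫ t in Set.Ioc (0:ℝ) 1, (m+1:ℝ) * (1 - t) ^ m * t ^ α =
      Real.Gamma (α + 1) * (Real.Gamma (m + 2) / Real.Gamma (m + 2 + α)) := by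
  have h := ProbabilityTheory.beta_eq_betaIntegralReal (α + 1) (m + 1) (by linarith) (by positivity)
  have h2 : (Complex.betaIntegral ((α + 1 : ℝ) : ℂ) ((m + 1 : ℝ) : ℂ)) =
      ((∫ t in Set.Ioc (0:ℝ) 1, (1 - t) ^ m * t ^ α : ℝ) : ℂ) := by
    rw [Complex.betaIntegral, intervalIntegral.integral_of_le zero_le_one, ← integral_complex_ofReal]
    apply setIntegral_congr_fun measurableSet_Ioc
    intro t ht
    simp only
    push_cast
    rw [Complex.ofReal_cpow ht.1.le]
    simp [mul_comm]
  rw [h2, Complex.ofReal_re, ProbabilityTheory.beta] at h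
  simp only [mul_assoc]
  rw [integral_const_mul, ← h, show (m + 2 : ℝ) = (m + 1) + 1 by ring,
    Real.Gamma_add_one (s := (m + 1 : ℝ)) (by positivity)]
  rw [show α + 1 + (m + 1 : ℝ) = m + 1 + 1 + α by ring]
  ring

lemma aux_gamma (x α : ℝ) (hx : 0 < x) (hα0 : 0 < α) (hα1 : α < 1) :
    |Real.Gamma (x + 1) / Real.Gamma (x + 1 + α) - x ^ (-α)| ≤ x ^ (-(α + 1)) := by
  have g0 := Real.Gamma_pos_of_pos hx
  have ga := Real.Gamma_pos_of_pos (show 0 < x + α by linarith)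
  have u : Real.Gamma (x + α) ≤ x ^ α * Real.Gamma x := by
    have := Real.Gamma_mul_add_mul_le_rpow_Gamma_mul_rpow_Gamma (s := x) (t := x + 1) (a := 1 - α)
      (b := α) hx (by linarith) (by linarith) hα0 (by ring)
    rw [show (1 - α) * x + α * (x + 1) = x + α by ring, Real.Gamma_add_one hx.ne',
      Real.mul_rpow hx.le g0.le] at this
    calc _ ≤ _ := this
      _ = x ^ α * (Real.Gamma x ^ (1 - α) * Real.Gamma x ^ α) := by ring
      _ = _ := by rw [← Real.rpow_add g0]; simp
  have l : Real.Gamma (x + 1) ≤ (x + α) ^ (1 - α) * Real.Gamma (x + α) := by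
    have := Real.Gamma_mul_add_mul_le_rpow_Gamma_mul_rpow_Gamma (s := x + α) (t := x + α + 1)
      (a := α) (b := 1 - α) (by linarith) (by linarith) hα0 (by linarith) (by ring)
    rw [show α * (x + α) + (1 - α) * (x + α + 1) = x + 1 by ring,
      Real.Gamma_add_one (s := x + α) (by linarith),
      Real.mul_rpow (by linarith) ga.le] at this
    calc _ ≤ _ := this
      _ = (x + α) ^ (1 - α) * (Real.Gamma (x + α) ^ α * Real.Gamma (x + α) ^ (1 - α)) := by ring
      _ = _ := by rw [← Real.rpow_add ga]; simp
  have hxa : 0 < x + α := by linarith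
  have e : Real.Gamma (x + 1 + α) = (x + α) * Real.Gamma (x + α) := by
    rw [← Real.Gamma_add_one hxa.ne']; ring_nf
  have hp := Real.rpow_pos_of_pos hx (-α)
  have up : Real.Gamma (x + 1) / Real.Gamma (x + 1 + α) ≤ x ^ (-α) := by
    rw [e, div_le_iff₀ (by positivity)]
    calc _ ≤ _ := l
      _ = (x + α) ^ (-α) * ((x + α) * Real.Gamma (x + α)) := by
        rw [show 1 - α = -α + 1 by ring, Real.rpow_add_one hxa.ne']; ring
      _ ≤ _ := by
        gcongr ?_ * _
        exact Real.rpow_le_rpow_of_nonpos hx (by linarith) (by linarith)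
  have lo : x ^ (-α) - x ^ (-(α + 1)) ≤ Real.Gamma (x + 1) / Real.Gamma (x + 1 + α) := by
    rw [e, le_div_iff₀ (by positivity), Real.Gamma_add_one hx.ne']
    have e2 : x ^ (-(α + 1)) * x = x ^ (-α) := by
      rw [← Real.rpow_add_one hx.ne']; ring_nf
    have e3 : x ^ (-α) * x ^ α = 1 := by rw [← Real.rpow_add hx]; simp
    have hq := Real.rpow_pos_of_pos hx (-(α + 1))
    have e4 : (x ^ (-α) - x ^ (-(α + 1))) * (x + α) ≤ x ^ (-α) * x := by
      rw [← e2]; nlinarith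
    calc (x ^ (-α) - x ^ (-(α + 1))) * ((x + α) * Real.Gamma (x + α))
        = ((x ^ (-α) - x ^ (-(α + 1))) * (x + α)) * Real.Gamma (x + α) := by ring
      _ ≤ (x ^ (-α) * x) * Real.Gamma (x + α) := by gcongr
      _ ≤ (x ^ (-α) * x) * (x ^ α * Real.Gamma x) := by gcongr
      _ = (x ^ (-α) * x ^ α) * (x * Real.Gamma x) := by ring
      _ = _ := by rw [e3, one_mul]
  rw [abs_le]
  constructor
  · linarith
  · have := Real.rpow_pos_of_pos hx (-(α + 1)); linarith

lemma aux_err (m : ℕ) (β : ℝ) (hβ : 0 < β) :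
    ∫ t in Set.Ioc (0:ℝ) 1, (m+1:ℝ) * (1 - t) ^ m * t ^ β ≤
      Real.exp 1 * Real.Gamma (β + 1) * (m + 1 : ℝ) ^ (-β) := by
  have hm : (0:ℝ) < m + 1 := by positivity
  have key := Real.integral_rpow_mul_exp_neg_mul_Ioi (a := β + 1) (r := m + 1) (by linarith) hm
  have hG := Real.Gamma_pos_of_pos (show 0 < β + 1 by linarith)
  have hint : IntegrableOn (fun t : ℝ => t ^ (β + 1 - 1) * Real.exp (-((m+1:ℝ) * t))) (Set.Ioi 0) :=
    .of_integral_ne_zero (by rw [key]; positivity)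
  have hint2 : IntegrableOn (fun t : ℝ => (Real.exp 1 * (m + 1)) * (t ^ (β + 1 - 1) * Real.exp (-((m+1:ℝ) * t)))) (Set.Ioi 0) :=
    hint.const_mul (Real.exp 1 * (m + 1))
  calc _ ≤ ∫ t in Set.Ioc (0:ℝ) 1, (Real.exp 1 * (m + 1)) * (t ^ (β + 1 - 1) * Real.exp (-((m+1:ℝ) * t))) := by
        apply setIntegral_mono_on
        · refine Continuous.integrableOn_Ioc ?_
          have : Continuous fun t : ℝ => t ^ β := Real.continuous_rpow_const hβ.le
          fun_prop
        · exact hint2.mono_set Set.Ioc_subset_Ioi_self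
        · exact measurableSet_Ioc
        · intro t ht
          have : (1 - t) ^ m ≤ Real.exp 1 * Real.exp (-((m+1:ℝ) * t)) := by
            calc (1 - t) ^ m ≤ (Real.exp (-t)) ^ m := by
                  gcongr
                  · linarith [ht.2]
                  · linarith [Real.add_one_le_exp (-t)]
              _ = Real.exp (-(m * t)) := by rw [← Real.exp_nat_mul]; ring_nf
              _ ≤ _ := by
                rw [← Real.exp_add]; gcongr; linarith [ht.2]
          have ht0 := Real.rpow_nonneg ht.1.le β
          rw [add_sub_cancel_right]
          calc _ ≤ (m+1:ℝ) * (Real.exp 1 * Real.exp (-((m+1:ℝ) * t))) * t ^ β := by gcongr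
            _ = _ := by ring
    _ ≤ ∫ t in Set.Ioi (0:ℝ), (Real.exp 1 * (m + 1)) * (t ^ (β + 1 - 1) * Real.exp (-((m+1:ℝ) * t))) := by
        apply setIntegral_mono_set hint2
        · refine (ae_restrict_iff' measurableSet_Ioi).2 (ae_of_all _ fun t ht => ?_)
          have := Real.rpow_nonneg (le_of_lt ht) (β + 1 - 1)
          simp only [Pi.zero_apply]
          positivity
        · exact Set.Ioc_subset_Ioi_self.eventuallyLE
    _ = _ := by
        rw [integral_const_mul, key, one_div, Real.inv_rpow hm.le, Real.rpow_add_one hm.ne',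
          Real.rpow_neg hm.le]
        field_simp

lemma aux_bound (Λ : Measure ℝ) [IsProbabilityMeasure Λ] (A α ς : ℝ)
    (hA : 0 < A) (hα0 : 0 < α) (hς : 0 < ς)
    (hΛ : (fun x : ℝ => (Λ (Set.Icc 0 x)).toReal - A * x ^ α)
      =O[nhdsWithin 0 (Set.Ioi 0)] fun x : ℝ => x ^ (α + ς)) :
    ∃ K > 0, ∀ t ∈ Set.Ioc (0:ℝ) 1,
      |(Λ (Set.Icc 0 t)).toReal - A * t ^ α| ≤ K * t ^ (α + min 1 ς) := by
  obtain ⟨C, hC, h⟩ := hΛ.exists_pos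
  rw [IsBigOWith, eventually_nhdsWithin_iff, Metric.eventually_nhds_iff] at h
  obtain ⟨δ, hδ, h⟩ := h
  set β := α + min 1 ς with hβ
  have hβ0 : 0 < β := by positivity
  have hd := Real.rpow_pos_of_pos hδ β
  refine ⟨C + (1 + A) / δ ^ β, by positivity, fun t ht => ?_⟩
  have htp := Real.rpow_pos_of_pos ht.1 β
  rcases lt_or_ge t δ with htd | htd
  · have h1 := h (y := t) (by simpa [abs_of_pos ht.1] using htd) ht.1
    rw [Real.norm_eq_abs, Real.norm_eq_abs, abs_of_pos (Real.rpow_pos_of_pos ht.1 _)] at h1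
    have h2 : t ^ (α + ς) ≤ t ^ β :=
      Real.rpow_le_rpow_of_exponent_ge ht.1 ht.2 (by rw [hβ]; gcongr; exact min_le_right _ _)
    calc _ ≤ _ := h1
      _ ≤ C * t ^ β := by gcongr
      _ ≤ _ := by gcongr; linarith [show 0 < (1 + A) / δ ^ β by positivity]
  · have h1 : (Λ (Set.Icc 0 t)).toReal ≤ 1 := by
      simpa using ENNReal.toReal_mono ENNReal.one_ne_top (prob_le_one (μ := Λ) (s := Set.Icc 0 t))
    have h2 : t ^ α ≤ 1 := Real.rpow_le_one ht.1.le ht.2 hα0.le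
    have h3 := Real.rpow_pos_of_pos ht.1 α
    have h4 : (0:ℝ) ≤ (Λ (Set.Icc 0 t)).toReal := ENNReal.toReal_nonneg
    have h5 : δ ^ β ≤ t ^ β := Real.rpow_le_rpow hδ.le htd hβ0.le
    have h6 : 1 + A ≤ (1 + A) / δ ^ β * t ^ β := by
      rw [div_mul_eq_mul_div, le_div_iff₀ hd]; gcongr
    have h7 : A * t ^ α ≤ A := by nlinarith
    have h8 : 0 < A * t ^ α := by positivity
    have : 0 < C * t ^ β := by positivity
    rw [add_mul, abs_le]; constructor <;> linarith

theorem stmt9 (Λ : Measure ℝ) [IsProbabilityMeasure Λ] (A α ς : ℝ)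
    (hA : 0 < A) (hα0 : 0 < α) (hα1 : α < 1) (hς : 0 < ς)
    (hΛ : (fun x : ℝ => (Λ (Set.Icc 0 x)).toReal - A * x ^ α)
      =O[nhdsWithin 0 (Set.Ioi 0)] fun x : ℝ => x ^ (α + ς)) :
    (fun n : ℕ => nuMom Λ n - A * Real.Gamma (α + 1) * (n : ℝ) ^ (-α))
      =O[atTop] fun n : ℕ => (n : ℝ) ^ (-(α + min 1 ς)) := by
  obtain ⟨K, hK, hb⟩ := aux_bound Λ A α ς hA hα0 hς hΛ
  set β := α + min 1 ς with hβ
  have hβ0 : 0 < β := by positivity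
  have hG := Real.Gamma_pos_of_pos (show 0 < α + 1 by linarith)
  refine IsBigO.of_bound (K * (Real.exp 1 * Real.Gamma (β + 1)) + A * Real.Gamma (α + 1)) ?_
  filter_upwards [eventually_ge_atTop 1] with n hn
  obtain ⟨m, rfl⟩ : ∃ m, n = m + 1 := ⟨n - 1, by omega⟩
  have hm : (0:ℝ) < m + 1 := by positivity
  have hca : Continuous fun t : ℝ => t ^ α := Real.continuous_rpow_const hα0.le
  have hcb : Continuous fun t : ℝ => t ^ β := Real.continuous_rpow_const hβ0.le
  have i1 : IntegrableOn (fun t : ℝ => (m+1:ℝ) * (1 - t) ^ m * t ^ α) (Set.Ioc 0 1) :=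
    Continuous.integrableOn_Ioc (by fun_prop)
  have i2 : IntegrableOn (fun t : ℝ => (m+1:ℝ) * (1 - t) ^ m * t ^ β) (Set.Ioc 0 1) :=
    Continuous.integrableOn_Ioc (by fun_prop)
  have hmono : Monotone fun t : ℝ => (Λ (Set.Icc 0 t)).toReal := fun s t hst =>
    ENNReal.toReal_mono (measure_ne_top _ _) (measure_mono (Set.Icc_subset_Icc_right hst))
  have i3 : IntegrableOn (fun t : ℝ => (m+1:ℝ) * (1 - t) ^ m * (Λ (Set.Icc 0 t)).toReal)
      (Set.Ioc 0 1) := by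
    refine Integrable.mul_bdd (c := 1) ?_ hmono.measurable.aestronglyMeasurable ?_
    · exact Continuous.integrableOn_Ioc (by fun_prop)
    · refine ae_of_all _ fun t => ?_
      rw [Real.norm_eq_abs, abs_of_nonneg ENNReal.toReal_nonneg]
      simpa using ENNReal.toReal_mono ENNReal.one_ne_top (prob_le_one (μ := Λ) (s := Set.Icc 0 t))
  have E : |nuMom Λ (m+1) - A * ∫ t in Set.Ioc (0:ℝ) 1, (m+1:ℝ) * (1 - t) ^ m * t ^ α|
      ≤ K * (Real.exp 1 * Real.Gamma (β + 1) * (m + 1 : ℝ) ^ (-β)) := by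
    rw [aux_fubini, ← integral_const_mul, ← integral_sub i3 (i1.const_mul A)]
    rw [← Real.norm_eq_abs]
    refine (norm_integral_le_of_norm_le (i2.const_mul K) ?_).trans ?_
    · refine (ae_restrict_iff' measurableSet_Ioc).2 (ae_of_all _ fun t ht => ?_)
      have hp : 0 ≤ (m+1:ℝ) * (1 - t) ^ m :=
        mul_nonneg hm.le (pow_nonneg (by linarith [ht.2]) _)
      rw [show (m+1:ℝ) * (1 - t) ^ m * (Λ (Set.Icc 0 t)).toReal - A * ((m+1:ℝ) * (1 - t) ^ m * t ^ α)
        = (m+1:ℝ) * (1 - t) ^ m * ((Λ (Set.Icc 0 t)).toReal - A * t ^ α) by ring, Real.norm_eq_abs,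
        abs_mul, abs_of_nonneg hp]
      calc _ ≤ (m+1:ℝ) * (1 - t) ^ m * (K * t ^ β) := by gcongr; exact hb t ht
        _ = _ := by ring
    · rw [integral_const_mul]
      gcongr
      exact aux_err m β hβ0
  have G := aux_gamma (m + 1) α hm hα0 hα1
  rw [aux_beta m α hα0, show (m + 2 : ℝ) = m + 1 + 1 by ring] at E
  have P : (m + 1 : ℝ) ^ (-(α + 1)) ≤ (m + 1 : ℝ) ^ (-β) :=
    Real.rpow_le_rpow_of_exponent_le (by linarith [(Nat.cast_nonneg m : (0:ℝ) ≤ m)])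
      (by rw [hβ]; linarith [min_le_left 1 ς])
  push_cast
  set r := Real.Gamma ((m:ℝ) + 1 + 1) / Real.Gamma (m + 1 + 1 + α)
  rw [Real.norm_eq_abs, Real.norm_eq_abs, abs_of_pos (Real.rpow_pos_of_pos hm _)]
  calc |nuMom Λ (m+1) - A * Real.Gamma (α + 1) * (m + 1 : ℝ) ^ (-α)|
      = |(nuMom Λ (m+1) - A * (Real.Gamma (α + 1) * r)) +
        A * Real.Gamma (α + 1) * (r - (m + 1 : ℝ) ^ (-α))| := by congr 1; ring
    _ ≤ |nuMom Λ (m+1) - A * (Real.Gamma (α + 1) * r)| +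
        |A * Real.Gamma (α + 1) * (r - (m + 1 : ℝ) ^ (-α))| := abs_add_le _ _
    _ ≤ K * (Real.exp 1 * Real.Gamma (β + 1) * (m + 1 : ℝ) ^ (-β)) +
        A * Real.Gamma (α + 1) * (m + 1 : ℝ) ^ (-β) := by
        rw [abs_mul (A * _), abs_of_pos (show 0 < A * Real.Gamma (α + 1) by positivity)]
        gcongr
        exact G.trans P
    _ = _ := by ring
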